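/- (Quarter-sphere reduction of the θ-velocity under odd-odd symmetry, identity (2.2).) Let ω : S² → ℝ be bounded measurable and odd-odd symmetric, and let u be its Biot–Savart velocity. Then for every x ∈ S² with x₃ ≠ ±1, u(x)·e_θ(x) = ( 2x₃ / (π√(1−x₃²)) ) ∫_{S²_q} [ y₃((x₁−y₁)y₂ − (x₂−y₂)y₁) / ( |x−y|² |x−ȳ|² ) + y₃((x₂+y₂)x₁ − (x₁−y₁)x₂) / ( |x−ỹ|² |x−\bar{ỹ}|² ) ] ω(y) dσ(y), where ȳ := (y₁,y₂,−y₃), ỹ := (y₁,−y₂,y₃) and \bar{ỹ} := (y₁,−y₂,−y₃). -/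

import Mathlib

open MeasureTheory Real Filter Set
open scoped ENNReal NNReal

noncomputable section

abbrev E3 : Type := EuclideanSpace ℝ (Fin 3)

/-- The vector `(a, b, c)` in `ℝ³`. -/
def vec3 (a b c : ℝ) : E3 := (WithLp.equiv 2 (Fin 3 → ℝ)).symm ![a, b, c]

/-- Euclidean dot product in `ℝ³`. -/
def dot3 (x y : E3) : ℝ := x 0 * y 0 + x 1 * y 1 + x 2 * y 2

/-- Cross product in `ℝ³`. -/
def cross3 (x y : E3) : E3 :=
  vec3 (x 1 * y 2 - x 2 * y 1) (x 2 * y 0 - x 0 * y 2) (x 0 * y 1 - x 1 * y 0)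

/-- The unit sphere `S²` in `ℝ³`. -/
def S2 : Set E3 := Metric.sphere (0 : E3) 1

/-- The surface measure on `S²`: the 2-dimensional Hausdorff measure restricted to `S²`. -/
def sigma2 : Measure E3 := (μH[2] : Measure E3).restrict S2

/-- Spherical coordinates. -/
def sc (φ θ : ℝ) : E3 := vec3 (cos θ * cos φ) (cos θ * sin φ) (sin θ)

/-- The Biot–Savart velocity of a vorticity `ω` on the sphere. -/
def biotSavart (ω : E3 → ℝ) (x : E3) : E3 :=
  (2 * Real.pi)⁻¹ • ∫ y, (‖x - y‖ ^ 2)⁻¹ • ω y • cross3 x y ∂sigma2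

/-- The unit tangent vector `e_φ`. -/
def ephi (y : E3) : E3 := vec3 (-(y 1) / sqrt (1 - (y 2) ^ 2)) (y 0 / sqrt (1 - (y 2) ^ 2)) 0

/-- The unit tangent vector `e_θ`. -/
def etheta (y : E3) : E3 :=
  vec3 (-(y 2) * y 0 / sqrt (1 - (y 2) ^ 2)) (-(y 2) * y 1 / sqrt (1 - (y 2) ^ 2))
    (sqrt (1 - (y 2) ^ 2))

/-- Reflection in the second coordinate: `ỹ`. -/
def flip2 (y : E3) : E3 := vec3 (y 0) (-(y 1)) (y 2)

/-- Reflection in the third coordinate: `ȳ`. -/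
def flip3 (y : E3) : E3 := vec3 (y 0) (y 1) (-(y 2))

/-- `ω` is odd-odd symmetric on the sphere. -/
def OddOdd (ω : E3 → ℝ) : Prop := ∀ x ∈ S2, ω (flip2 x) = -ω x ∧ ω (flip3 x) = -ω x

def x₀ : E3 := vec3 1 0 0

/-- The region `Q(k₁, k₂)` on the sphere. -/
def Qset (k₁ k₂ : ℝ) : Set E3 :=
  (fun p : ℝ × ℝ => sc p.1 p.2) '' (Ioo k₁ Real.pi ×ˢ Ioo k₂ (Real.pi / 2))

/-- The open quarter sphere. -/
def S2q : Set E3 := {y ∈ S2 | 0 < y 1 ∧ 0 < y 2}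

/-- The (possibly infinite) Lipschitz constant of `f` on the set `s`. -/
def lipOn (f : ℝ × ℝ → ℝ) (s : Set (ℝ × ℝ)) : ℝ≥0∞ :=
  ⨆ p ∈ s, ⨆ q ∈ s, edist (f p) (f q) / edist p q

lemma vec3_0 (a b c : ℝ) : (vec3 a b c) 0 = a := rfl
lemma vec3_1 (a b c : ℝ) : (vec3 a b c) 1 = b := rfl
lemma vec3_2 (a b c : ℝ) : (vec3 a b c) 2 = c := rfl

lemma E3ext {x y : E3} (h0 : x 0 = y 0) (h1 : x 1 = y 1) (h2 : x 2 = y 2) : x = y := by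
  ext i; fin_cases i
  · exact h0
  · exact h1
  · exact h2

lemma nsq (x : E3) : ‖x‖ ^ 2 = x 0 ^ 2 + x 1 ^ 2 + x 2 ^ 2 := by
  rw [EuclideanSpace.norm_sq_eq, Fin.sum_univ_three]; simp

lemma nsq_sub (x y : E3) :
    ‖x - y‖ ^ 2 = (x 0 - y 0) ^ 2 + (x 1 - y 1) ^ 2 + (x 2 - y 2) ^ 2 := by
  rw [nsq]; simp

lemma memS2 {x : E3} : x ∈ S2 ↔ x 0 ^ 2 + x 1 ^ 2 + x 2 ^ 2 = 1 := by
  rw [← nsq, S2, mem_sphere_zero_iff_norm]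
  constructor
  · intro h; rw [h]; norm_num
  · intro h; nlinarith [norm_nonneg x]

lemma measS2 : MeasurableSet S2 := Metric.isClosed_sphere.measurableSet

lemma flip2_flip2 (x : E3) : flip2 (flip2 x) = x := by
  apply E3ext <;> simp [flip2, vec3_0, vec3_1, vec3_2]
lemma flip3_flip3 (x : E3) : flip3 (flip3 x) = x := by
  apply E3ext <;> simp [flip3, vec3_0, vec3_1, vec3_2]

lemma nflip2 (x y : E3) : ‖flip2 x - flip2 y‖ = ‖x - y‖ := by
  rw [← sq_eq_sq₀ (norm_nonneg _) (norm_nonneg _), nsq_sub, nsq_sub]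
  simp only [flip2, vec3_0, vec3_1, vec3_2]; ring
lemma nflip3 (x y : E3) : ‖flip3 x - flip3 y‖ = ‖x - y‖ := by
  rw [← sq_eq_sq₀ (norm_nonneg _) (norm_nonneg _), nsq_sub, nsq_sub]
  simp only [flip3, vec3_0, vec3_1, vec3_2]; ring

def f2e : E3 ≃ᵢ E3 where
  toFun := flip2
  invFun := flip2
  left_inv := flip2_flip2
  right_inv := flip2_flip2
  isometry_toFun := Isometry.of_dist_eq fun x y => by rw [dist_eq_norm, dist_eq_norm, nflip2]

def f3e : E3 ≃ᵢ E3 where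
  toFun := flip3
  invFun := flip3
  left_inv := flip3_flip3
  right_inv := flip3_flip3
  isometry_toFun := Isometry.of_dist_eq fun x y => by rw [dist_eq_norm, dist_eq_norm, nflip3]

lemma mp_of (e : E3 ≃ᵢ E3) (h : ∀ y, e y ∈ S2 ↔ y ∈ S2) : MeasurePreserving e sigma2 sigma2 := by
  have h1 := (e.measurePreserving_hausdorffMeasure 2).restrict_preimage measS2
  have h2 : e ⁻¹' S2 = S2 := by ext y; exact h y
  rw [h2] at h1
  exact h1

lemma flip2_S2 (y : E3) : flip2 y ∈ S2 ↔ y ∈ S2 := by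
  rw [memS2, memS2]; simp [flip2, vec3_0, vec3_1, vec3_2]
lemma flip3_S2 (y : E3) : flip3 y ∈ S2 ↔ y ∈ S2 := by
  rw [memS2, memS2]; simp [flip3, vec3_0, vec3_1, vec3_2]

lemma mp2 : MeasurePreserving flip2 sigma2 sigma2 := mp_of f2e flip2_S2
lemma mp3 : MeasurePreserving flip3 sigma2 sigma2 := mp_of f3e flip3_S2
lemma me2 : MeasurableEmbedding flip2 := f2e.toHomeomorph.measurableEmbedding
lemma me3 : MeasurableEmbedding flip3 := f3e.toHomeomorph.measurableEmbedding

/-- inverse stereographic projection -/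
def stG (p : Fin 2 → ℝ) : E3 :=
  vec3 (2 * p 0 / (1 + p 0 ^ 2 + p 1 ^ 2)) (2 * p 1 / (1 + p 0 ^ 2 + p 1 ^ 2))
    ((1 - p 0 ^ 2 - p 1 ^ 2) / (1 + p 0 ^ 2 + p 1 ^ 2))

lemma stG_contDiff : ContDiff ℝ 1 stG := by
  rw [contDiff_euclidean]
  have h0 : ∀ p : Fin 2 → ℝ, 1 + p 0 ^ 2 + p 1 ^ 2 ≠ 0 := fun p => by positivity
  intro i
  fin_cases i
  · change ContDiff ℝ 1 fun p : Fin 2 → ℝ => 2 * p 0 / (1 + p 0 ^ 2 + p 1 ^ 2)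
    exact ContDiff.div (by fun_prop) (by fun_prop) h0
  · change ContDiff ℝ 1 fun p : Fin 2 → ℝ => 2 * p 1 / (1 + p 0 ^ 2 + p 1 ^ 2)
    exact ContDiff.div (by fun_prop) (by fun_prop) h0
  · change ContDiff ℝ 1 fun p : Fin 2 → ℝ => (1 - p 0 ^ 2 - p 1 ^ 2) / (1 + p 0 ^ 2 + p 1 ^ 2)
    exact ContDiff.div (by fun_prop) (by fun_prop) h0

lemma meas_coord (i : Fin 3) : Measurable (fun y : E3 => y i) := by fun_prop

def north : E3 := vec3 0 0 1
def DD : Set (Fin 2 → ℝ) := Metric.closedBall 0 1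
def Hup : Set E3 := {y | 0 ≤ y 2}

lemma measHup : MeasurableSet Hup := measurableSet_le measurable_const (meas_coord 2)

lemma north_dist (p : Fin 2 → ℝ) (hp : p ∈ DD) : ‖p‖ ≤ ‖north - stG p‖ := by
  have hp' : ‖p‖ ≤ 1 := by simpa [DD] using hp
  have h0 : |p 0| ≤ ‖p‖ := norm_le_pi_norm p 0
  have h1 : |p 1| ≤ ‖p‖ := norm_le_pi_norm p 1
  have hn : ‖p‖ ^ 2 ≤ p 0 ^ 2 + p 1 ^ 2 := by
    have : ‖p‖ ≤ √(p 0 ^ 2 + p 1 ^ 2) := by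
      rw [pi_norm_le_iff_of_nonneg (sqrt_nonneg _)]
      intro i
      apply Real.le_sqrt_of_sq_le
      fin_cases i <;> simp <;> positivity
    calc ‖p‖ ^ 2 ≤ √(p 0 ^ 2 + p 1 ^ 2) ^ 2 := by gcongr
      _ = _ := Real.sq_sqrt (by positivity)
  have hu0 : p 0 ^ 2 ≤ 1 := by rw [← sq_abs]; nlinarith [abs_nonneg (p 0)]
  have hu1 : p 1 ^ 2 ≤ 1 := by rw [← sq_abs]; nlinarith [abs_nonneg (p 1)]
  have key : ‖north - stG p‖ ^ 2 = 4 * (p 0 ^ 2 + p 1 ^ 2) / (1 + p 0 ^ 2 + p 1 ^ 2) := by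
    rw [nsq_sub]; simp only [north, stG, vec3_0, vec3_1, vec3_2]
    have : 1 + p 0 ^ 2 + p 1 ^ 2 ≠ 0 := by positivity
    field_simp; ring
  apply le_of_sq_le_sq _ (norm_nonneg _)
  rw [key, le_div_iff₀ (by positivity)]
  nlinarith [sq_nonneg ‖p‖, sq_nonneg (p 0), sq_nonneg (p 1)]

lemma Hup_sub : S2 ∩ Hup ⊆ stG '' DD := by
  rintro y ⟨hy, hy2⟩
  rw [memS2] at hy
  have hy2 : 0 ≤ y 2 := hy2
  have h12 : 0 < 1 + y 2 := by linarith
  refine ⟨![y 0 / (1 + y 2), y 1 / (1 + y 2)], ?_, ?_⟩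
  · simp only [DD, mem_closedBall_zero_iff]
    rw [pi_norm_le_iff_of_nonneg zero_le_one]
    have aux : ∀ t : ℝ, t ^ 2 ≤ 1 → |t / (1 + y 2)| ≤ 1 := by
      intro t ht
      rw [abs_div, abs_of_pos h12, div_le_one h12]
      have : |t| ≤ 1 := by rwa [← sq_le_one_iff_abs_le_one]
      linarith
    intro i
    fin_cases i
    · exact aux (y 0) (by nlinarith)
    · exact aux (y 1) (by nlinarith)
  · have hs : 1 + (y 0 / (1 + y 2)) ^ 2 + (y 1 / (1 + y 2)) ^ 2 = 2 / (1 + y 2) := by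
      field_simp; nlinarith
    have hs' : 1 - (y 0 / (1 + y 2)) ^ 2 - (y 1 / (1 + y 2)) ^ 2 = 2 * y 2 / (1 + y 2) := by
      field_simp; nlinarith
    apply E3ext
    · simp only [stG, vec3_0, Matrix.cons_val_zero, Matrix.cons_val_one, hs]; field_simp
    · simp only [stG, vec3_1, Matrix.cons_val_zero, Matrix.cons_val_one, hs]; field_simp
    · simp only [stG, vec3_2, Matrix.cons_val_zero, Matrix.cons_val_one, hs, hs']; field_simp

lemma measure_le : ∃ K : ℝ≥0, sigma2.restrict Hup ≤
    (K : ℝ≥0∞) • Measure.map stG (volume.restrict DD) := by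
  obtain ⟨K, hK⟩ := (stG_contDiff.contDiffOn (s := DD)).exists_lipschitzOnWith one_ne_zero
    (convex_closedBall _ _) (isCompact_closedBall _ _)
  refine ⟨K ^ 2, ?_⟩
  rw [Measure.le_iff]
  intro A hA
  have hm : Measurable stG := stG_contDiff.continuous.measurable
  rw [Measure.restrict_apply hA, sigma2, Measure.restrict_apply (hA.inter measHup),
    Measure.smul_apply, Measure.map_apply hm hA, Measure.restrict_apply (hm hA)]
  have hsub : A ∩ Hup ∩ S2 ⊆ stG '' (stG ⁻¹' A ∩ DD) := by
    rintro y ⟨⟨hyA, hyH⟩, hyS⟩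
    obtain ⟨p, hp, rfl⟩ := Hup_sub ⟨hyS, hyH⟩
    exact ⟨p, ⟨hyA, hp⟩, rfl⟩
  refine (measure_mono hsub).trans ?_
  refine ((hK.mono inter_subset_right).hausdorffMeasure_image_le (d := 2) (by norm_num)).trans ?_
  have := @hausdorffMeasure_pi_real (Fin 2) _
  simp only [Fintype.card_fin, Nat.cast_ofNat] at this
  rw [this]
  simp

lemma int_DD : IntegrableOn (fun p : Fin 2 → ℝ => ‖p‖⁻¹) DD := by
  have : IntegrableOn (fun p : Fin 2 → ℝ => ‖p‖⁻¹) (Metric.ball 0 2) := by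
    rw [integrableOn_fun_norm_addHaar volume (f := fun t => t⁻¹)]
    have h : IntegrableOn (fun _ : ℝ => (1 : ℝ)) (Ioo 0 2) := by simp
    refine h.congr_fun (fun t ht => ?_) measurableSet_Ioo
    have : t ≠ 0 := ht.1.ne'
    simp [this]
  exact this.mono_set (Metric.closedBall_subset_ball (by norm_num))

lemma int_up : IntegrableOn (fun y : E3 => ‖north - y‖⁻¹) Hup sigma2 := by
  obtain ⟨K, hK⟩ := measure_le
  refine Integrable.mono_measure ?_ hK
  refine Integrable.smul_measure ?_ (by simp)
  rw [integrable_map_measure (by fun_prop) stG_contDiff.continuous.aemeasurable]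
  refine Integrable.mono' int_DD ?_ ?_
  · have := stG_contDiff.continuous.measurable
    exact Measurable.aestronglyMeasurable (by fun_prop)
  · rw [ae_restrict_iff' (show MeasurableSet DD from Metric.isClosed_closedBall.measurableSet)]
    refine Eventually.of_forall fun p hp => ?_
    have h := north_dist p hp
    simp only [Function.comp, norm_inv, norm_norm]
    rcases eq_or_lt_of_le (norm_nonneg p) with h0 | h0
    · have : p = 0 := by simpa using h0.symm
      subst this
      have : north - stG 0 = 0 := by
        apply E3ext <;> simp [north, stG, vec3_0, vec3_1, vec3_2]
      simp [this]
    · gcongr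

lemma fin_up : sigma2 Hup < ⊤ := by
  obtain ⟨K, hK⟩ := measure_le
  have h := hK univ
  rw [Measure.restrict_apply_univ] at h
  refine h.trans_lt ?_
  rw [Measure.smul_apply, Measure.map_apply stG_contDiff.continuous.measurable MeasurableSet.univ]
  simp only [preimage_univ, Measure.restrict_apply_univ, smul_eq_mul]
  exact ENNReal.mul_lt_top (by simp) (isCompact_closedBall _ _).measure_lt_top

lemma fin_down : sigma2 Hupᶜ < ⊤ := by
  have h : Hupᶜ ⊆ flip3 ⁻¹' Hup := by
    intro y hy
    simp only [Hup, mem_compl_iff, mem_ofPred_eq, not_le, mem_preimage, flip3, vec3_2] at *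
    linarith
  refine (measure_mono h).trans_lt ?_
  rw [mp3.measure_preimage measHup.nullMeasurableSet]
  exact fin_up

lemma int_north : Integrable (fun y : E3 => ‖north - y‖⁻¹) sigma2 := by
  rw [← integrableOn_univ, ← union_compl_self Hup]
  refine int_up.union ?_
  have : IntegrableOn (fun _ : E3 => (1 : ℝ)) Hupᶜ sigma2 := by
    simpa using fin_down
  refine Integrable.mono' this (by fun_prop) ?_
  rw [ae_restrict_iff' measHup.compl]
  refine Eventually.of_forall fun y hy => ?_
  simp only [Hup, mem_compl_iff, mem_ofPred_eq, not_le] at hy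
  simp only [norm_inv, norm_norm]
  apply inv_le_one_of_one_le₀
  apply le_of_sq_le_sq _ (norm_nonneg _)
  rw [nsq_sub]; simp only [north, vec3_0, vec3_1, vec3_2]
  nlinarith [sq_nonneg (y 0), sq_nonneg (y 1)]

lemma int_x (x : E3) (hx : x ∈ S2) : Integrable (fun y : E3 => ‖x - y‖⁻¹) sigma2 := by
  have hn : ‖x‖ = ‖north‖ := by
    have h1 : ‖x‖ = 1 := by simpa [S2] using hx
    have h2 : north ∈ S2 := by rw [memS2]; simp [north, vec3_0, vec3_1, vec3_2]
    have h2 : ‖north‖ = 1 := by simpa [S2] using h2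
    rw [h1, h2]
  let e := (ℝ ∙ (x - north))ᗮ.reflection
  have he : e x = north := Submodule.reflection_sub hn
  have hmp : MeasurePreserving e.toIsometryEquiv sigma2 sigma2 := by
    apply mp_of
    intro y
    simp [S2]
  have := (hmp.integrable_comp_emb e.toHomeomorph.measurableEmbedding).2 int_north
  refine this.congr (Eventually.of_forall fun y => ?_)
  change ‖north - e y‖⁻¹ = ‖x - y‖⁻¹
  rw [← he, ← map_sub, e.norm_map]

lemma half_fold (f : E3 → E3) (i : Fin 3) (hmp : MeasurePreserving f sigma2 sigma2)
    (hme : MeasurableEmbedding f) (hf : ∀ y, f y i = -(y i)) (J : E3 → ℝ)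
    (hJ : Integrable J sigma2) (h0 : ∀ y ∈ S2, y i = 0 → J y = 0) :
    ∫ y, J y ∂sigma2 = ∫ y in {y | 0 < y i}, (J y + J (f y)) ∂sigma2 := by
  have hA : MeasurableSet {y : E3 | 0 < y i} := measurableSet_lt measurable_const (meas_coord i)
  have hB : MeasurableSet {y : E3 | y i < 0} := measurableSet_lt (meas_coord i) measurable_const
  have hJf : Integrable (fun y => J (f y)) sigma2 := (hmp.integrable_comp_emb hme).2 hJ
  rw [integral_add hJ.integrableOn hJf.integrableOn, ← integral_add_compl hA hJ]
  congr 1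
  have hpre : f ⁻¹' {y : E3 | y i < 0} = {y : E3 | 0 < y i} := by
    ext y; simp [hf]
  rw [← hpre, hmp.setIntegral_preimage_emb hme J]
  rw [← integral_indicator (by rw [hpre]; exact hA.compl), ← integral_indicator hB]
  apply integral_congr_ae
  rw [sigma2, EventuallyEq, ae_restrict_iff' measS2]
  refine Eventually.of_forall fun y hy => ?_
  rw [hpre]
  simp only [indicator, mem_compl_iff, mem_ofPred_eq, not_lt]
  rcases lt_trichotomy (y i) 0 with h | h | h
  · simp [h, h.le]
  · simp [h, h0 y hy h]
  · simp [h.not_ge, h.not_gt]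

lemma cross_bound (x y : E3) (hx : x ∈ S2) (hy : y ∈ S2) : ‖cross3 x y‖ ≤ ‖x - y‖ := by
  rw [memS2] at hx hy
  apply le_of_sq_le_sq _ (norm_nonneg _)
  rw [nsq_sub, nsq]
  simp only [cross3, vec3_0, vec3_1, vec3_2]
  have e : (x 1 * y 2 - x 2 * y 1) ^ 2 + (x 2 * y 0 - x 0 * y 2) ^ 2 + (x 0 * y 1 - x 1 * y 0) ^ 2
    = (x 0 ^ 2 + x 1 ^ 2 + x 2 ^ 2) * (y 0 ^ 2 + y 1 ^ 2 + y 2 ^ 2)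
      - (x 0 * y 0 + x 1 * y 1 + x 2 * y 2) ^ 2 := by ring
  rw [e, hx, hy]
  nlinarith [sq_nonneg (x 0 * y 0 + x 1 * y 1 + x 2 * y 2 - 1)]

lemma cross_meas (x : E3) : Measurable (cross3 x) := by
  have : Continuous (cross3 x) := by
    unfold cross3 vec3
    apply (PiLp.continuous_toLp 2 _).comp
    refine continuous_pi fun i => ?_
    fin_cases i <;> simp <;> fun_prop
  exact this.measurable

lemma int_BS (ω : E3 → ℝ) (M : ℝ) (hmeas : Measurable ω) (hbdd : ∀ y, |ω y| ≤ M) (x : E3)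
    (hx : x ∈ S2) : Integrable (fun y => (‖x - y‖ ^ 2)⁻¹ • ω y • cross3 x y) sigma2 := by
  have hM : 0 ≤ M := (abs_nonneg _).trans (hbdd 0)
  refine Integrable.mono' ((int_x x hx).const_mul M) ?_ ?_
  · have := cross_meas x
    exact Measurable.aestronglyMeasurable (by fun_prop)
  · rw [sigma2, ae_restrict_iff' measS2]
    refine Eventually.of_forall fun y hy => ?_
    rw [norm_smul, norm_smul, norm_inv, norm_pow, norm_norm, Real.norm_eq_abs]
    rcases eq_or_lt_of_le (norm_nonneg (x - y)) with h0 | h0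
    · simp [← h0]
    · calc (‖x - y‖ ^ 2)⁻¹ * (|ω y| * ‖cross3 x y‖)
          ≤ (‖x - y‖ ^ 2)⁻¹ * (M * ‖x - y‖) := by
            gcongr
            · exact hbdd y
            · exact cross_bound x y hx hy
        _ = M * ‖x - y‖⁻¹ := by field_simp

/-- the scalar kernel -/
def KK (ω : E3 → ℝ) (x y : E3) : ℝ := (‖x - y‖ ^ 2)⁻¹ * (x 0 * y 1 - x 1 * y 0) * ω y

def dotL (v : E3) : E3 →L[ℝ] ℝ :=
  (v 0) • EuclideanSpace.proj 0 + (v 1) • EuclideanSpace.proj 1 + (v 2) • EuclideanSpace.proj 2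

lemma dotL_apply (v w : E3) : dotL v w = dot3 w v := by
  simp [dotL, dot3]; ring

lemma quarter_fold (ω : E3 → ℝ) (hsym : OddOdd ω) (x : E3) (hK : Integrable (KK ω x) sigma2) :
    ∫ y, KK ω x y ∂sigma2 = ∫ y in S2q, (KK ω x y + KK ω x (flip3 y) +
      (KK ω x (flip2 y) + KK ω x (flip3 (flip2 y)))) ∂sigma2 := by
  have hA : ∀ i : Fin 3, MeasurableSet {y : E3 | 0 < y i} :=
    fun i => measurableSet_lt measurable_const (meas_coord i)
  have z2 : ∀ y ∈ S2, y 1 = 0 → ω y = 0 := by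
    intro y hy h
    have := (hsym y hy).1
    have e : flip2 y = y := by apply E3ext <;> simp [flip2, vec3_0, vec3_1, vec3_2, h]
    rw [e] at this; linarith
  have z3 : ∀ y ∈ S2, y 2 = 0 → ω y = 0 := by
    intro y hy h
    have := (hsym y hy).2
    have e : flip3 y = y := by apply E3ext <;> simp [flip3, vec3_0, vec3_1, vec3_2, h]
    rw [e] at this; linarith
  rw [half_fold flip3 2 mp3 me3 (fun y => rfl) _ hK (fun y hy h => by simp [KK, z3 y hy h])]
  have hK3 : Integrable (fun y => KK ω x (flip3 y)) sigma2 := (mp3.integrable_comp_emb me3).2 hK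
  rw [← integral_indicator (hA 2)]
  rw [half_fold flip2 1 mp2 me2 (fun y => rfl)
    ({y : E3 | 0 < y 2}.indicator (fun y => KK ω x y + KK ω x (flip3 y)))
    ((hK.add hK3).indicator (hA 2))]
  · rw [← integral_indicator (hA 1), ← integral_indicator]
    · apply integral_congr_ae
      rw [sigma2, EventuallyEq, ae_restrict_iff' measS2]
      refine Eventually.of_forall fun y hy => ?_
      have e2 : (flip2 y) 2 = y 2 := rfl
      by_cases h1 : 0 < y 1 <;> by_cases h2 : 0 < y 2 <;>
        simp [indicator, S2q, hy, h1, h2, e2]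
    · have : S2q = S2 ∩ ({y : E3 | 0 < y 1} ∩ {y : E3 | 0 < y 2}) := by
        ext y; simp [S2q]; tauto
      rw [this]
      exact measS2.inter ((hA 1).inter (hA 2))
  · intro y hy h
    have a := z2 y hy h
    have b := z2 (flip3 y) ((flip3_S2 y).2 hy) h
    simp [indicator, KK, a, b]

/-- Quarter-sphere reduction of the `θ`-velocity under odd-odd
symmetry, identity (2.2). -/
theorem quarter_sphere_reduction_theta (ω : E3 → ℝ) (M : ℝ) (hmeas : Measurable ω)
    (hbdd : ∀ y, |ω y| ≤ M) (hsym : OddOdd ω) :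
    ∀ x ∈ S2, x 2 ≠ 1 → x 2 ≠ -1 →
      dot3 (biotSavart ω x) (etheta x) =
        (2 * x 2 / (Real.pi * sqrt (1 - (x 2) ^ 2))) *
          ∫ y in S2q,
            (y 2 * ((x 0 - y 0) * y 1 - (x 1 - y 1) * y 0) /
                (‖x - y‖ ^ 2 * ‖x - flip3 y‖ ^ 2) +
              y 2 * ((x 1 + y 1) * x 0 - (x 0 - y 0) * x 1) /
                (‖x - flip2 y‖ ^ 2 * ‖x - flip2 (flip3 y)‖ ^ 2)) *
            ω y ∂sigma2 := by

  intro x hx h1 h2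
  have hx' := memS2.1 hx
  have hs : 0 < 1 - x 2 ^ 2 := by
    have : 0 ≤ 1 - x 2 ^ 2 := by nlinarith [sq_nonneg (x 0), sq_nonneg (x 1)]
    refine lt_of_le_of_ne this fun h => ?_
    have : (1 - x 2) * (1 + x 2) = 0 := by linarith
    rcases mul_eq_zero.1 this with h | h
    · exact h1 (by linarith)
    · exact h2 (by linarith)
  have hr : 0 < √(1 - x 2 ^ 2) := Real.sqrt_pos.2 hs
  have hrr : √(1 - x 2 ^ 2) ^ 2 = 1 - x 2 ^ 2 := Real.sq_sqrt hs.le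
  have hBS := int_BS ω M hmeas hbdd x hx
  set r := √(1 - x 2 ^ 2) with hrdef
  have hpt : ∀ y, dotL (etheta x) ((‖x - y‖ ^ 2)⁻¹ • ω y • cross3 x y) = r⁻¹ * KK ω x y := by
    intro y
    rw [map_smul, map_smul, dotL_apply, KK]
    have : dot3 (cross3 x y) (etheta x) = r⁻¹ * (x 0 * y 1 - x 1 * y 0) := by
      simp only [dot3, cross3, etheta, vec3_0, vec3_1, vec3_2, ← hrdef]
      field_simp
      rw [hrr]
      ring
    rw [this]; simp only [smul_eq_mul]; ring
  have hI : Integrable (fun y => r⁻¹ * KK ω x y) sigma2 := by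
    refine ((dotL (etheta x)).integrable_comp hBS).congr (Eventually.of_forall hpt)
  have hK : Integrable (KK ω x) sigma2 := by
    refine (hI.const_mul r).congr (Eventually.of_forall fun y => ?_)
    field_simp
  have lhs : dot3 (biotSavart ω x) (etheta x) = (2 * Real.pi)⁻¹ * (r⁻¹ * ∫ y, KK ω x y ∂sigma2) := by
    rw [← dotL_apply, biotSavart, map_smul, ← ContinuousLinearMap.integral_comp_comm _ hBS]
    simp only [hpt, smul_eq_mul]
    rw [integral_const_mul]
  rw [lhs, quarter_fold ω hsym x hK]
  have key : ∫ y in S2q, (KK ω x y + KK ω x (flip3 y) +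
      (KK ω x (flip2 y) + KK ω x (flip3 (flip2 y)))) ∂sigma2 = ∫ y in S2q, (4 * x 2) *
        ((y 2 * ((x 0 - y 0) * y 1 - (x 1 - y 1) * y 0) /
                (‖x - y‖ ^ 2 * ‖x - flip3 y‖ ^ 2) +
              y 2 * ((x 1 + y 1) * x 0 - (x 0 - y 0) * x 1) /
                (‖x - flip2 y‖ ^ 2 * ‖x - flip2 (flip3 y)‖ ^ 2)) *
            ω y) ∂sigma2 := by
    have : NullSingletonClass (μH[2] : Measure E3) :=
      Measure.nullSingletonClass_hausdorff E3 (by norm_num)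
    have hne : ∀ z : E3, ∀ᵐ y ∂(sigma2.restrict S2q), y ≠ z := by
      intro z
      refine ae_restrict_of_ae ?_
      rw [sigma2]
      refine ae_restrict_of_ae ?_
      rw [ae_iff]; simp
    have hS : ∀ᵐ y ∂(sigma2.restrict S2q), y ∈ S2 := by
      refine ae_restrict_of_ae ?_
      exact ae_restrict_mem measS2
    apply integral_congr_ae
    filter_upwards [hS, hne x, hne (flip3 x), hne (flip2 x), hne (flip3 (flip2 x))]
      with y hy n0 n3 n2 n23
    have comm : flip3 (flip2 y) = flip2 (flip3 y) := rfl
    have w3 := (hsym y hy).2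
    have w2 := (hsym y hy).1
    have w23 : ω (flip2 (flip3 y)) = ω y := by
      rw [(hsym _ ((flip3_S2 y).2 hy)).1, w3, neg_neg]
    have p0 : ‖x - y‖ ^ 2 ≠ 0 := by
      simpa [sub_eq_zero] using fun h => n0 h.symm
    have p3 : ‖x - flip3 y‖ ^ 2 ≠ 0 := by
      simpa [sub_eq_zero] using fun h => n3 (by rw [h, flip3_flip3])
    have p2 : ‖x - flip2 y‖ ^ 2 ≠ 0 := by
      simpa [sub_eq_zero] using fun h => n2 (by rw [h, flip2_flip2])
    have p23 : ‖x - flip2 (flip3 y)‖ ^ 2 ≠ 0 := by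
      simpa [sub_eq_zero] using fun h => n23 (by rw [h, flip2_flip2, flip3_flip3])
    have d3 : ‖x - flip3 y‖ ^ 2 = ‖x - y‖ ^ 2 + 4 * x 2 * y 2 := by
      rw [nsq_sub, nsq_sub]; simp only [flip3, vec3_0, vec3_1, vec3_2]; ring
    have d23 : ‖x - flip2 (flip3 y)‖ ^ 2 = ‖x - flip2 y‖ ^ 2 + 4 * x 2 * y 2 := by
      rw [nsq_sub, nsq_sub]; simp only [flip2, flip3, vec3_0, vec3_1, vec3_2]; ring
    simp only [KK, comm, w2, w3, w23]
    rw [d3] at p3 ⊢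
    rw [d23] at p23 ⊢
    have c1 : (flip3 y) 0 = y 0 := rfl
    have c2 : (flip3 y) 1 = y 1 := rfl
    have c3 : (flip2 y) 0 = y 0 := rfl
    have c4 : (flip2 y) 1 = - y 1 := rfl
    have c5 : (flip2 (flip3 y)) 0 = y 0 := rfl
    have c6 : (flip2 (flip3 y)) 1 = - y 1 := rfl
    rw [c1, c2, c3, c4, c5, c6]
    generalize ‖x - y‖ ^ 2 = a at *
    generalize ‖x - flip2 y‖ ^ 2 = b at *
    field_simp
    ring
  rw [key, integral_const_mul]
  have := Real.pi_pos
  generalize (integral (sigma2.restrict S2q) (_ : E3 → ℝ) : ℝ) = I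
  field_simp
  ring
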